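/- For every w, v ∈ ℝ^d and every δ > 0, the symmetric finite-difference approximation of the Hessian-vector product satisfies ‖∇²f(w)·v − (∇f(w + δv) − ∇f(w − δv))/(2δ)‖ ≤ ρ δ ‖v‖². -/

import Mathlib

/-- The gradient of a twice continuously differentiable function is differentiable. -/
theorem ContDiff.differentiable_gradient {E : Type*} [NormedAddCommGroup E]
    [InnerProductSpace ℝ E] [CompleteSpace E] {f : E → ℝ} (hf : ContDiff ℝ 2 f) :
    Differentiable ℝ (gradient f) :=
  (InnerProductSpace.toDual ℝ E).symm.toContinuousLinearEquiv.differentiable.comp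
    ((hf.fderiv_right (m := 1) (by norm_num)).differentiable (by norm_num))

/-- If the derivative of `g` is `ρ`-Lipschitz, symmetric difference quotients of `g` with step `δ`
approximate directional derivatives along `v` up to `ρ * δ * ‖v‖ ^ 2`. -/
theorem norm_fderiv_sub_symm_diff_quotient_le {E F : Type*} [NormedAddCommGroup E]
    [NormedSpace ℝ E] [NormedAddCommGroup F] [NormedSpace ℝ F] {g : E → F} {ρ : ℝ}
    (hg : Differentiable ℝ g) (hρ : 0 ≤ ρ)
    (hlip : ∀ w u, ‖fderiv ℝ g w - fderiv ℝ g u‖ ≤ ρ * ‖w - u‖)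
    (w v : E) {δ : ℝ} (hδ : 0 < δ) :
    ‖fderiv ℝ g w v - (2 * δ)⁻¹ • (g (w + δ • v) - g (w - δ • v))‖ ≤ ρ * δ * ‖v‖ ^ 2 := by
  have hnorm : ‖δ • v‖ = δ * ‖v‖ := by rw [norm_smul, Real.norm_of_nonneg hδ.le]
  have hdiff : w + δ • v - (w - δ • v) = (2 * δ) • v := by module
  have key := (convex_closedBall w (δ * ‖v‖)).norm_image_sub_le_of_norm_fderiv_le'
    (f := g) (φ := fderiv ℝ g w) (C := ρ * (δ * ‖v‖)) (x := w - δ • v) (y := w + δ • v)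
    (fun x _ => hg x)
    (fun x hx => (hlip x w).trans
      (mul_le_mul_of_nonneg_left (mem_closedBall_iff_norm.1 hx) hρ))
    (by simp [hnorm]) (by simp [hnorm])
  rw [hdiff, map_smul, norm_smul, Real.norm_of_nonneg (by positivity)] at key
  have hfactor : fderiv ℝ g w v - (2 * δ)⁻¹ • (g (w + δ • v) - g (w - δ • v)) =
      -((2 * δ)⁻¹ • (g (w + δ • v) - g (w - δ • v) - (2 * δ) • fderiv ℝ g w v)) := by
    rw [smul_sub (2 * δ)⁻¹ (g (w + δ • v) - g (w - δ • v)),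
      inv_smul_smul₀ (by positivity), neg_sub]
  rw [hfactor, norm_neg, norm_smul, Real.norm_of_nonneg (by positivity),
    inv_mul_le_iff₀ (by positivity)]
  exact key.trans_eq (by ring)

/-- **Accuracy of the symmetric finite-difference Hessian-vector product** (used by
HF-MAML): for every `w, v` and `δ > 0`,
`‖∇²f(w)·v − (∇f(w + δv) − ∇f(w − δv))/(2δ)‖ ≤ ρδ‖v‖²`. -/
theorem hessian_vector_finite_difference
    {d : ℕ} (f : EuclideanSpace ℝ (Fin d) → ℝ) (hf : ContDiff ℝ 2 f)
    (ρ : ℝ) (hρ : 0 < ρ)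
    (hhess : ∀ w u,
      ‖fderiv ℝ (gradient f) w - fderiv ℝ (gradient f) u‖ ≤ ρ * ‖w - u‖) :
    ∀ (w v : EuclideanSpace ℝ (Fin d)) (δ : ℝ), 0 < δ →
      ‖fderiv ℝ (gradient f) w v -
          (2 * δ)⁻¹ • (gradient f (w + δ • v) - gradient f (w - δ • v))‖ ≤
        ρ * δ * ‖v‖ ^ 2 := by
  intro w v δ hδ
  exact norm_fderiv_sub_symm_diff_quotient_le hf.differentiable_gradient hρ.le hhess w v hδ
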